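/- arXiv:2402.08362 — 2 statements merged into one kernel-verified Lean document; each statement's English description precedes it below -/
import Mathlib

section
/- Let λ₁,…,λ_N be distinct complex numbers with Im λ_j > 0, and let m₁,…,m_N ∈ ℕ. Consider the Hermitian matrix C of size Σ_{j=1}^N (m_j+1), with rows indexed by pairs (j,r) with 1 ≤ j ≤ N, 1 ≤ r ≤ m_j+1 and columns by pairs (k,s) with 1 ≤ k ≤ N, 1 ≤ s ≤ m_k+1, whose entries are C_{(j,r),(k,s)} = −i·(−1)^{r−1}·binom(r+s−2, r−1)·(conj(λ_j) − λ_k)^{−(r+s−1)}. Then C is Hermitian and positive definite. -/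
open scoped ComplexOrder

/-- The Cauchy-type matrix with `(j,r),(k,s)` entry (zero-based `r`, `s`)
`−i (−1)^r binom(r+s, r) (conj(λ_j) − λ_k)^{−(r+s+1)}`. -/
noncomputable def cauchyMat (N : ℕ) (lam : Fin N → ℂ) (m : Fin N → ℕ) :
    Matrix ((j : Fin N) × Fin (m j + 1)) ((j : Fin N) × Fin (m j + 1)) ℂ :=
  Matrix.of fun p q =>
    -Complex.I * (-1) ^ (p.2 : ℕ) * (Nat.choose ((p.2 : ℕ) + (q.2 : ℕ)) (p.2 : ℕ) : ℂ) *
      (((starRingEnd ℂ) (lam p.1) - lam q.1) ^ ((p.2 : ℕ) + (q.2 : ℕ) + 1))⁻¹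

open MeasureTheory Polynomial

theorem integrableOn_Ioi_pow_mul_cexp (n : ℕ) {z : ℂ} (hz : 0 < z.re) :
    IntegrableOn (fun t : ℝ => (t : ℂ) ^ n * Complex.exp (-z * t)) (Set.Ioi 0) := by
  have h := integrableOn_rpow_mul_exp_neg_mul_rpow (s := n) (p := 1) (b := z.re)
    (by linarith [n.cast_nonneg (α := ℝ)]) one_pos hz
  refine Integrable.mono' h (Continuous.aestronglyMeasurable (by fun_prop)) ?_
  filter_upwards [ae_restrict_mem measurableSet_Ioi] with t ht
  simp [Complex.norm_exp, abs_of_pos (Set.mem_Ioi.1 ht)]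

theorem tendsto_pow_mul_cexp_atTop (n : ℕ) {z : ℂ} (hz : 0 < z.re) :
    Filter.Tendsto (fun t : ℝ => (t : ℂ) ^ n * Complex.exp (-z * t)) Filter.atTop (nhds 0) := by
  rw [tendsto_zero_iff_norm_tendsto_zero]
  refine (tendsto_rpow_mul_exp_neg_mul_atTop_nhds_zero n z.re hz).congr' ?_
  filter_upwards [Filter.eventually_gt_atTop 0] with t ht
  simp [Complex.norm_exp, abs_of_pos ht]

theorem integral_Ioi_pow_mul_cexp (n : ℕ) {z : ℂ} (hz : 0 < z.re) :
    ∫ t in Set.Ioi (0 : ℝ), (t : ℂ) ^ n * Complex.exp (-z * t) =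
      n.factorial * (z ^ (n + 1))⁻¹ := by
  have hz0 : z ≠ 0 := by rintro rfl; simp at hz
  induction n with
  | zero =>
    simp only [pow_zero, one_mul]
    rw [integral_exp_mul_complex_Ioi (by simpa using hz)]
    simp
  | succ n ih =>
    have hd (t : ℝ) : HasDerivAt (fun t : ℝ => (t : ℂ) ^ (n + 1) * Complex.exp (-z * t))
        ((n + 1 : ℂ) * ((t : ℂ) ^ n * Complex.exp (-z * t)) -
          z * ((t : ℂ) ^ (n + 1) * Complex.exp (-z * t))) t := by
      have h := ((hasDerivAt_pow (n + 1) (t : ℂ)).mul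
        ((hasDerivAt_id (t : ℂ)).const_mul (-z)).cexp).comp_ofReal
      refine h.congr_deriv ?_
      simp
      ring
    have h1 := (integrableOn_Ioi_pow_mul_cexp n hz).const_mul (n + 1 : ℂ)
    have h2 := (integrableOn_Ioi_pow_mul_cexp (n + 1) hz).const_mul z
    have h := integral_Ioi_of_hasDerivAt_of_tendsto' (a := 0) (fun t _ => hd t) (h1.sub h2)
      (tendsto_pow_mul_cexp_atTop (n + 1) hz)
    rw [integral_sub h1 h2, integral_const_mul, integral_const_mul, ih] at h
    have h' : z * ∫ t in Set.Ioi (0 : ℝ), (t : ℂ) ^ (n + 1) * Complex.exp (-z * t) =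
        (n + 1) * (n.factorial * (z ^ (n + 1))⁻¹) := by
      refine (sub_eq_zero.1 (h.trans ?_)).symm
      simp
    apply mul_left_cancel₀ hz0
    rw [h', Nat.factorial_succ]
    push_cast
    field_simp
    ring

/-- Exponential polynomials with distinct frequencies are linearly independent on a half-line. -/
theorem eq_zero_of_sum_eval_mul_cexp_eq_zero {ι : Type*} [Fintype ι] {μ : ι → ℂ}
    (hμ : Function.Injective μ) (p : ι → ℂ[X])
    (hp : ∀ t : ℝ, 0 < t → ∑ k, (p k).eval (t : ℂ) * Complex.exp (μ k * t) = 0) : p = 0 := by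
  classical
  induction hM : ∑ k, (if p k = 0 then 0 else (p k).natDegree + 1) using Nat.strong_induction_on
    generalizing p with
  | _ M ih =>
  by_contra hne
  obtain ⟨k, hk⟩ : ∃ k, p k ≠ 0 := Function.ne_iff.1 hne
  let q : ι → ℂ[X] := fun j => derivative (p j) + C (μ j - μ k) * p j
  have hq : ∀ t : ℝ, 0 < t → ∑ j, (q j).eval (t : ℂ) * Complex.exp (μ j * t) = 0 := by
    intro t ht
    have hd : HasDerivAt (fun t : ℝ => ∑ j, (p j).eval (t : ℂ) * Complex.exp (μ j * t))
        (∑ j, ((derivative (p j)).eval (t : ℂ) * Complex.exp (μ j * t) +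
          (p j).eval (t : ℂ) * (Complex.exp (μ j * t) * μ j))) t := by
      refine HasDerivAt.fun_sum fun j _ => HasDerivAt.mul ?_ ?_
      · exact ((p j).hasDerivAt (t : ℂ)).comp_ofReal
      · have := ((hasDerivAt_id (t : ℂ)).const_mul (μ j)).cexp.comp_ofReal
        simpa using this
    have hz : HasDerivAt (fun t : ℝ => ∑ j, (p j).eval (t : ℂ) * Complex.exp (μ j * t)) 0 t :=
      (hasDerivAt_const t (0 : ℂ)).congr_of_eventuallyEq
        (Filter.eventuallyEq_of_mem (Ioi_mem_nhds ht) hp)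
    have h0 := hd.unique hz
    calc ∑ j, (q j).eval (t : ℂ) * Complex.exp (μ j * t)
        = ∑ j, ((derivative (p j)).eval (t : ℂ) * Complex.exp (μ j * t) +
          (p j).eval (t : ℂ) * (Complex.exp (μ j * t) * μ j)) -
          μ k * ∑ j, (p j).eval (t : ℂ) * Complex.exp (μ j * t) := by
          rw [Finset.mul_sum, ← Finset.sum_sub_distrib]
          refine Finset.sum_congr rfl fun j _ => ?_
          simp only [q, eval_add, eval_mul, eval_C]
          ring
      _ = 0 := by rw [h0, hp t ht]; simp
  have hdeg (j : ι) (hj : j ≠ k) : q j ≠ 0 ∨ p j = 0 := by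
    by_contra! h
    have hc : μ j - μ k ≠ 0 := sub_ne_zero.2 (hμ.ne hj)
    have h1 : derivative (p j) = -(C (μ j - μ k) * p j) := eq_neg_of_add_eq_zero_left h.1
    have h2 := degree_derivative_lt h.2
    rw [h1, degree_neg, degree_C_mul hc] at h2
    exact h2.false
  have hq0 : q = 0 := by
    refine ih _ ?_ q hq rfl
    rw [← hM]
    refine Finset.sum_lt_sum (fun j _ => ?_) ⟨k, Finset.mem_univ _, ?_⟩
    · by_cases hj : p j = 0
      · simp [q, hj]
      · have : (q j).natDegree ≤ (p j).natDegree := by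
          refine natDegree_add_le_of_degree_le ?_ (natDegree_C_mul_le _ _)
          exact (natDegree_derivative_le _).trans (Nat.sub_le _ _)
        simp only [hj, if_false]
        split_ifs <;> omega
    · have hqk : q k = derivative (p k) := by simp [q]
      simp only [hqk, hk, if_false]
      split_ifs with h
      · omega
      · have : (p k).natDegree ≠ 0 := fun h0 => h (by rw [eq_C_of_natDegree_eq_zero h0]; simp)
        have := natDegree_derivative_lt this
        omega
  have hpj (j : ι) (hj : j ≠ k) : p j = 0 :=
    (hdeg j hj).resolve_left fun h => h (congrFun hq0 j)
  refine hk (eq_zero_of_infinite_isRoot _ (Set.Infinite.mono ?_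
    ((Set.Ioi_infinite (0 : ℝ)).image Complex.ofReal_injective.injOn)))
  rintro _ ⟨t, ht, rfl⟩
  have h := hp t ht
  rw [Finset.sum_eq_single k (fun j _ hj => by simp [hpj j hj]) (by simp)] at h
  exact (mul_eq_zero.1 h).resolve_right (Complex.exp_ne_zero _)

/-- The functions whose Gram matrix in `L²(0, ∞)` is `cauchyMat`. -/
noncomputable def cauchyFun (r : ℕ) (l : ℂ) (t : ℝ) : ℂ :=
  (Complex.I * t) ^ r / r.factorial * Complex.exp (Complex.I * l * t)

@[fun_prop]
theorem continuous_cauchyFun (r : ℕ) (l : ℂ) : Continuous (cauchyFun r l) := by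
  unfold cauchyFun
  fun_prop

theorem star_cauchyFun_mul_cauchyFun (r s : ℕ) (l l' : ℂ) (t : ℝ) :
    star (cauchyFun r l t) * cauchyFun s l' t =
      (-Complex.I) ^ r * Complex.I ^ s / (r.factorial * s.factorial) *
        ((t : ℂ) ^ (r + s) *
          Complex.exp (-(Complex.I * ((starRingEnd ℂ) l - l')) * t)) := by
  have he : Complex.exp (-(Complex.I * ((starRingEnd ℂ) l - l')) * t) =
      Complex.exp (-Complex.I * (starRingEnd ℂ) l * t) * Complex.exp (Complex.I * l' * t) := by
    rw [← Complex.exp_add]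
    ring_nf
  simp only [cauchyFun, Complex.star_def, map_mul, map_div₀, map_pow, Complex.conj_I,
    Complex.conj_ofReal, map_natCast, ← Complex.exp_conj, he]
  ring

theorem re_I_mul_conj_sub_pos {l l' : ℂ} (hl : 0 < l.im) (hl' : 0 < l'.im) :
    0 < (Complex.I * ((starRingEnd ℂ) l - l')).re := by
  simp
  linarith

theorem integrableOn_star_cauchyFun_mul_cauchyFun (r s : ℕ) {l l' : ℂ}
    (hl : 0 < l.im) (hl' : 0 < l'.im) :
    IntegrableOn (fun t => star (cauchyFun r l t) * cauchyFun s l' t) (Set.Ioi 0) := by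
  simp only [star_cauchyFun_mul_cauchyFun]
  exact (integrableOn_Ioi_pow_mul_cexp _ (re_I_mul_conj_sub_pos hl hl')).const_mul _

theorem cauchyMat_apply_eq_integral {N : ℕ} {lam : Fin N → ℂ} (him : ∀ j, 0 < (lam j).im)
    (m : Fin N → ℕ) (p q : (j : Fin N) × Fin (m j + 1)) :
    cauchyMat N lam m p q = ∫ t in Set.Ioi (0 : ℝ),
      star (cauchyFun p.2 (lam p.1) t) * cauchyFun q.2 (lam q.1) t := by
  have hz := re_I_mul_conj_sub_pos (him p.1) (him q.1)
  simp only [star_cauchyFun_mul_cauchyFun, integral_const_mul, integral_Ioi_pow_mul_cexp _ hz]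
  simp only [cauchyMat, Matrix.of_apply, mul_pow, mul_inv]
  generalize (p.2 : ℕ) = r
  generalize (q.2 : ℕ) = s
  have hc : ((r + s).choose r : ℂ) = (r + s).factorial / (r.factorial * s.factorial) := by
    rw [Nat.cast_add_choose]
  have hi : -Complex.I * (-1) ^ r = (-Complex.I) ^ r * Complex.I ^ s *
      (Complex.I ^ (r + s + 1))⁻¹ := by
    rw [eq_mul_inv_iff_mul_eq₀ (pow_ne_zero _ Complex.I_ne_zero), neg_pow Complex.I]
    linear_combination (-(-1 : ℂ) ^ r * Complex.I ^ r * Complex.I ^ s) * Complex.I_sq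
  rw [hc, hi]
  ring

theorem cauchyMat_isHermitian {N : ℕ} {lam : Fin N → ℂ} (him : ∀ j, 0 < (lam j).im)
    (m : Fin N → ℕ) : (cauchyMat N lam m).IsHermitian := by
  ext p q
  simp only [Matrix.conjTranspose_apply, cauchyMat_apply_eq_integral him]
  rw [Complex.star_def, ← integral_conj]
  simp [mul_comm]

theorem star_dotProduct_cauchyMat_mulVec {N : ℕ} {lam : Fin N → ℂ} (him : ∀ j, 0 < (lam j).im)
    (m : Fin N → ℕ) (x : (j : Fin N) × Fin (m j + 1) → ℂ) :
    IntegrableOn (fun t => ‖∑ p, x p * cauchyFun p.2 (lam p.1) t‖ ^ 2) (Set.Ioi 0) ∧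
    star x ⬝ᵥ (cauchyMat N lam m).mulVec x =
      ((∫ t in Set.Ioi (0 : ℝ), ‖∑ p, x p * cauchyFun p.2 (lam p.1) t‖ ^ 2 : ℝ) : ℂ) := by
  have hexp (t : ℝ) : ((‖∑ p, x p * cauchyFun p.2 (lam p.1) t‖ ^ 2 : ℝ) : ℂ) =
      ∑ p, ∑ q, star (x p) * x q *
        (star (cauchyFun p.2 (lam p.1) t) * cauchyFun q.2 (lam q.1) t) := by
    rw [Complex.ofReal_pow, ← Complex.conj_mul', map_sum, Finset.sum_mul_sum]
    refine Finset.sum_congr rfl fun p _ => Finset.sum_congr rfl fun q _ => ?_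
    simp only [map_mul, Complex.star_def]
    ring
  have hintegrable (p q : (j : Fin N) × Fin (m j + 1)) :=
    (integrableOn_star_cauchyFun_mul_cauchyFun p.2 q.2 (him p.1) (him q.1)).const_mul
      (star (x p) * x q)
  constructor
  · have h : IntegrableOn (fun t => ((‖∑ p, x p * cauchyFun p.2 (lam p.1) t‖ ^ 2 : ℝ) : ℂ))
        (Set.Ioi 0) := by
      simp only [hexp]
      exact integrable_finsetSum _ fun p _ => integrable_finsetSum _ fun q _ => hintegrable p q
    exact h.re
  · rw [← integral_complex_ofReal]
    simp only [hexp]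
    rw [integral_finsetSum _ fun p _ => integrable_finsetSum _ fun q _ => hintegrable p q]
    simp only [dotProduct, Matrix.mulVec, Finset.mul_sum]
    refine Finset.sum_congr rfl fun p _ => ?_
    rw [integral_finsetSum _ fun q _ => hintegrable p q]
    refine Finset.sum_congr rfl fun q _ => ?_
    rw [integral_const_mul, cauchyMat_apply_eq_integral him, Pi.star_apply]
    ring

theorem eq_zero_of_sum_mul_cauchyFun_eq_zero {N : ℕ} {lam : Fin N → ℂ}
    (hinj : Function.Injective lam) (m : Fin N → ℕ) (x : (j : Fin N) × Fin (m j + 1) → ℂ)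
    (hx : ∀ t : ℝ, 0 < t → ∑ p, x p * cauchyFun p.2 (lam p.1) t = 0) : x = 0 := by
  let c (j : Fin N) (r : Fin (m j + 1)) : ℂ :=
    x ⟨j, r⟩ * (Complex.I ^ (r : ℕ) / (r : ℕ).factorial)
  have hp := eq_zero_of_sum_eval_mul_cexp_eq_zero (μ := fun j => Complex.I * lam j)
    ((mul_right_injective₀ Complex.I_ne_zero).comp hinj)
    (fun j => ∑ r : Fin (m j + 1), monomial (r : ℕ) (c j r)) (fun t ht => by
      rw [← hx t ht, Fintype.sum_sigma]
      refine Finset.sum_congr rfl fun j _ => ?_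
      rw [eval_finsetSum, Finset.sum_mul]
      refine Finset.sum_congr rfl fun r _ => ?_
      simp only [eval_monomial, c, cauchyFun]
      ring)
  ext ⟨j, r⟩
  have h := congrArg (coeff · (r : ℕ)) (congrFun hp j)
  simpa [c, finsetSum_coeff, coeff_monomial, Fin.val_inj, Nat.factorial_ne_zero] using h

/-- For distinct `λ₁,…,λ_N` in the upper half-plane, the matrix with entries
`C_{(j,r),(k,s)} = −i (−1)^{r−1} binom(r+s−2, r−1) (conj(λ_j) − λ_k)^{−(r+s−1)}`
(one-based `r`, `s`) is Hermitian and positive definite. -/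
theorem cauchyMat_posDef (N : ℕ) (lam : Fin N → ℂ)
    (hinj : Function.Injective lam) (him : ∀ j, 0 < (lam j).im) (m : Fin N → ℕ) :
    (cauchyMat N lam m).IsHermitian ∧ (cauchyMat N lam m).PosDef := by
  refine ⟨cauchyMat_isHermitian him m,
    .of_dotProduct_mulVec_pos (cauchyMat_isHermitian him m) fun x hx => ?_⟩
  obtain ⟨hintegrable, heq⟩ := star_dotProduct_cauchyMat_mulVec him m x
  rw [heq, Complex.zero_lt_real]
  refine (integral_nonneg fun t => sq_nonneg _).lt_of_ne' fun h0 => hx ?_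
  rw [integral_eq_zero_iff_of_nonneg (fun t => sq_nonneg _) hintegrable] at h0
  have h := Measure.eqOn_open_of_ae_eq h0 isOpen_Ioi
    (Continuous.continuousOn <| .pow (.norm (by fun_prop)) 2) continuousOn_const
  exact eq_zero_of_sum_mul_cauchyFun_eq_zero hinj m x fun t ht => by simpa using h ht
end

section
/- Fix (x,t) ∈ ℝ², distinct complex numbers λ₁,…,λ_N with Im λ_k > 0, multiplicities m₁,…,m_N ∈ ℕ, and a polynomial f with symmetric 2×2 complex matrix coefficients such that f(λ_k) ≠ 0 for every k. Set θ(λ) = λx + 2λ²t, h(λ) = e^{2iθ(λ)}·f(λ), and let ȟ be the entire matrix-valued function ȟ(λ) = conj(h(conj(λ)))ᵀ, so that ȟ(conj(λ_j)) = h(λ_j)†. Let 𝒩 = 2·Σ_{k=1}^N (m_k+1) and define the 𝒩×𝒩 complex matrix A, with 2×2 blocks indexed by pairs, by A_{(j,r),(k,s)} = (−i/(r−1)!)·(d/dλ)^{r−1}[ ȟ(λ)·(λ−λ_k)^{−s} ] evaluated at λ = conj(λ_j), for 1 ≤ r ≤ m_j+1, 1 ≤ s ≤ m_k+1; define B by B_{(j,r),(k,s)}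 = A_{(j, m_j+2−r),(k, m_k+2−s)}. Then det(I_𝒩 + A·conj(B)) is a real number strictly greater than 1; in particular I_𝒩 + A·conj(B) is invertible and the linear system (I_𝒩 + A·conj(B))·X = H has a unique solution X ∈ ℂ^𝒩 for every H ∈ ℂ^𝒩. -/
open scoped Matrix BigOperators ComplexOrder

/-- The entry `ȟ(z)_{a b} = conj(h(conj z))ᵀ_{a b}` where
`h(z) = e^{2iθ(z)} f(z)` and `θ(z) = zx + 2z²t`. -/
noncomputable def hCheck (x t : ℝ) (f : Matrix (Fin 2) (Fin 2) (Polynomial ℂ))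
    (a b : Fin 2) (z : ℂ) : ℂ :=
  (starRingEnd ℂ)
    (Complex.exp (2 * Complex.I *
        ((starRingEnd ℂ) z * (x : ℂ) + 2 * ((starRingEnd ℂ) z) ^ 2 * (t : ℂ))) *
      (f b a).eval ((starRingEnd ℂ) z))

/-- The matrix `A` of the inverse-scattering linear system, with `2×2` blocks
`A_{(j,r),(k,s)} = (−i/r!)·(d/dλ)^r [ ȟ(λ)(λ−λ_k)^{−(s+1)} ]` at `λ = conj(λ_j)`
(zero-based `r`, `s`). -/
noncomputable def Amat (x t : ℝ) (N : ℕ) (lam : Fin N → ℂ) (m : Fin N → ℕ)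
    (f : Matrix (Fin 2) (Fin 2) (Polynomial ℂ)) :
    Matrix ((j : Fin N) × (Fin (m j + 1) × Fin 2)) ((j : Fin N) × (Fin (m j + 1) × Fin 2)) ℂ :=
  Matrix.of fun p q =>
    (-Complex.I / (Nat.factorial (p.2.1 : ℕ) : ℂ)) *
      iteratedDeriv (p.2.1 : ℕ)
        (fun z => hCheck x t f p.2.2 q.2.2 z * ((z - lam q.1) ^ ((q.2.1 : ℕ) + 1))⁻¹)
        ((starRingEnd ℂ) (lam p.1))

/-- The matrix `B`, obtained from `A` by reversing the order of derivatives within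
each block row and of pole orders within each block column:
`B_{(j,r),(k,s)} = A_{(j, m_j−r),(k, m_k−s)}` (zero-based). -/
noncomputable def Bmat (x t : ℝ) (N : ℕ) (lam : Fin N → ℂ) (m : Fin N → ℕ)
    (f : Matrix (Fin 2) (Fin 2) (Polynomial ℂ)) :
    Matrix ((j : Fin N) × (Fin (m j + 1) × Fin 2)) ((j : Fin N) × (Fin (m j + 1) × Fin 2)) ℂ :=
  Matrix.of fun p q =>
    Amat x t N lam m f ⟨p.1, (p.2.1.rev, p.2.2)⟩ ⟨q.1, (q.2.1.rev, q.2.2)⟩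

theorem Matrix.PosSemidef.one_lt_det_one_add {n : Type*} [Fintype n] [DecidableEq n]
    {S : Matrix n n ℂ} (hS : S.PosSemidef) (hne : S ≠ 0) : 1 < (1 + S).det := by
  have hdet : (1 + S).det = ((∏ i, (1 + hS.isHermitian.eigenvalues i) : ℝ) : ℂ) := by
    have h := congrArg (Polynomial.eval (-1)) hS.isHermitian.charpoly_eq
    have hneg : Matrix.scalar n (-1 : ℂ) - S = -(1 + S) := by
      simp only [map_neg, map_one]; abel
    rw [Matrix.eval_charpoly, hneg, Matrix.det_neg, Polynomial.eval_prod] at h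
    simp only [Polynomial.eval_sub, Polynomial.eval_X, Polynomial.eval_C,
      ← neg_add', Finset.prod_neg] at h
    have := mul_left_cancel₀ (pow_ne_zero _ (neg_ne_zero.mpr one_ne_zero)) h
    simpa using this
  rw [hdet, ← Complex.ofReal_one, Complex.real_lt_real]
  obtain ⟨i, hi⟩ : ∃ i, hS.isHermitian.eigenvalues i ≠ 0 := by
    by_contra! h
    exact hne (hS.isHermitian.eigenvalues_eq_zero_iff.mp (funext h))
  have hpos : 0 < hS.isHermitian.eigenvalues i := lt_of_le_of_ne (hS.eigenvalues_nonneg i) hi.symm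
  refine Finset.prod_const_one.symm.trans_lt (Finset.prod_lt_prod (f := fun _ => (1 : ℝ))
    (fun _ _ => one_pos) (fun j _ => ?_) ⟨i, Finset.mem_univ i, ?_⟩)
  · linarith [hS.eigenvalues_nonneg j]
  · linarith

open scoped MatrixOrder in
theorem Matrix.PosDef.one_lt_det_one_add_mul {n : Type*} [Fintype n] [DecidableEq n]
    {T G K : Matrix n n ℂ} (hG : G.PosDef) (hK : K.PosDef) (hT : T ≠ 0) :
    1 < (1 + T * G * Tᴴ * K).det := by
  obtain ⟨a, rfl⟩ := CStarAlgebra.nonneg_iff_eq_star_mul_self.mp hG.posSemidef.nonneg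
  obtain ⟨b, rfl⟩ := CStarAlgebra.nonneg_iff_eq_star_mul_self.mp hK.posSemidef.nonneg
  simp only [Matrix.star_eq_conjTranspose] at *
  have ha : IsUnit a := isUnit_of_mul_isUnit_right hG.isUnit
  have hb : IsUnit b := isUnit_of_mul_isUnit_right hK.isUnit
  have hb' : IsUnit bᴴ := isUnit_of_mul_isUnit_left hK.isUnit
  have heq : (1 + T * (aᴴ * a) * Tᴴ * (bᴴ * b)).det =
      (1 + (a * Tᴴ * bᴴ)ᴴ * (a * Tᴴ * bᴴ)).det := by
    rw [← Matrix.mul_assoc _ bᴴ b, Matrix.det_one_add_mul_comm]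
    simp only [Matrix.conjTranspose_mul, Matrix.conjTranspose_conjTranspose, Matrix.mul_assoc]
  rw [heq]
  refine (Matrix.posSemidef_conjTranspose_mul_self _).one_lt_det_one_add fun h => hT ?_
  rw [Matrix.conjTranspose_mul_self_eq_zero] at h
  rwa [hb'.mul_left_eq_zero, ha.mul_right_eq_zero, Matrix.conjTranspose_eq_zero] at h

open Polynomial in
theorem hasDerivAt_eval_mul_exp (p : ℂ[X]) (μ : ℂ) (y : ℝ) :
    HasDerivAt (fun y : ℝ => p.eval (y : ℂ) * Complex.exp (μ * y))
      ((derivative p + C μ * p).eval (y : ℂ) * Complex.exp (μ * y)) y := by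
  have h : HasDerivAt (fun z : ℂ => p.eval z * Complex.exp (μ * z))
      ((derivative p + C μ * p).eval (y : ℂ) * Complex.exp (μ * y)) y := by
    convert! (p.hasDerivAt (y : ℂ)).mul (((hasDerivAt_id (y : ℂ)).const_mul μ).cexp) using 1
    simp; ring
  exact h.comp_ofReal

open Polynomial in
theorem sum_twisted_derivative_mul_exp_eq_zero {ι : Type*} (s : Finset ι) (p : ι → ℂ[X])
    (μ : ι → ℂ) (c : ℂ)
    (h : ∀ y : ℝ, 0 < y → ∑ k ∈ s, (p k).eval (y : ℂ) * Complex.exp (μ k * y) = 0)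
    (y : ℝ) (hy : 0 < y) :
    ∑ k ∈ s, (derivative (p k) + C (μ k - c) * p k).eval (y : ℂ) * Complex.exp (μ k * y) = 0 := by
  have hd := HasDerivAt.fun_sum fun k (_ : k ∈ s) => hasDerivAt_eval_mul_exp (p k) (μ k) y
  have hz : (fun y : ℝ => ∑ k ∈ s, (p k).eval (y : ℂ) * Complex.exp (μ k * y)) =ᶠ[nhds y]
      fun _ => 0 := by
    filter_upwards [lt_mem_nhds hy] with z hz using h z hz
  have h0 := hd.unique ((hasDerivAt_const y (0 : ℂ)).congr_of_eventuallyEq hz)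
  have hc : ∑ k ∈ s, c * ((p k).eval (y : ℂ) * Complex.exp (μ k * y)) = 0 := by
    rw [← Finset.mul_sum, h y hy, mul_zero]
  rw [← sub_eq_zero.mpr (h0.trans hc.symm), ← Finset.sum_sub_distrib]
  refine Finset.sum_congr rfl fun k _ => ?_
  simp; ring

open Polynomial in
theorem derivative_add_C_mul_eq_zero {c : ℂ} (hc : c ≠ 0) {p : ℂ[X]}
    (h : derivative p + C c * p = 0) : p = 0 := by
  by_contra hp
  have hlt := degree_derivative_lt hp
  rw [eq_neg_of_add_eq_zero_left h, degree_neg, degree_C_mul hc] at hlt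
  exact lt_irrefl _ hlt

open Polynomial in
/-- Exponential polynomials with distinct exponents are linearly independent on `(0, ∞)`. -/
theorem eq_zero_of_sum_eval_mul_exp_eq_zero {ι : Type*} (μ : ι → ℂ)
    (hμ : Function.Injective μ) (s : Finset ι) (p : ι → ℂ[X])
    (h : ∀ y : ℝ, 0 < y → ∑ k ∈ s, (p k).eval (y : ℂ) * Complex.exp (μ k * y) = 0) :
    ∀ k ∈ s, p k = 0 := by
  classical
  induction s using Finset.induction_on generalizing p with
  | empty => simp
  | insert a s ha ih =>
    let D : ι → ℂ[X] → ℂ[X] := fun k q => derivative q + C (μ k - μ a) * q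
    have hD : ∀ n : ℕ, ∀ y : ℝ, 0 < y → ∑ k ∈ insert a s,
        ((D k)^[n] (p k)).eval (y : ℂ) * Complex.exp (μ k * y) = 0 := by
      intro n
      induction n with
      | zero => exact h
      | succ n ihn =>
        simp only [Function.iterate_succ_apply']
        exact sum_twisted_derivative_mul_exp_eq_zero _ _ μ (μ a) ihn
    have hDa : (D a)^[(p a).natDegree + 1] (p a) = 0 := by
      have : D a = derivative := by funext q; simp [D]
      rw [this]
      exact iterate_derivative_eq_zero (Nat.lt_succ_self _)
    have hs : ∀ k ∈ s, p k = 0 := by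
      intro k hk
      have hk0 := ih (fun k => (D k)^[(p a).natDegree + 1] (p k)) (fun y hy => by
        have := hD ((p a).natDegree + 1) y hy
        rwa [Finset.sum_insert ha, hDa, eval_zero, zero_mul, zero_add] at this) k hk
      have hne : μ k - μ a ≠ 0 := sub_ne_zero.mpr fun e => ha (hμ e ▸ hk)
      have hinj : ∀ n : ℕ, ∀ q : ℂ[X], (D k)^[n] q = 0 → q = 0 := by
        intro n
        induction n with
        | zero => exact fun _ hq => hq
        | succ n ihn => exact fun q hq => derivative_add_C_mul_eq_zero hne (ihn _ hq)
      exact hinj _ _ hk0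
    intro k hk
    rcases Finset.mem_insert.mp hk with rfl | hk
    · refine eq_zero_of_infinite_isRoot _ ((Set.Ioi_infinite (0 : ℝ)).image
        Complex.ofReal_injective.injOn |>.mono ?_)
      rintro _ ⟨y, hy, rfl⟩
      have := h y hy
      rw [Finset.sum_insert ha, Finset.sum_eq_zero fun j hj => by rw [hs j hj]; simp,
        add_zero] at this
      exact (mul_eq_zero.mp this).resolve_right (Complex.exp_ne_zero _)
    · exact hs k hk

open MeasureTheory Set in
theorem integrableOn_pow_mul_cexp_Ioi (n : ℕ) {μ : ℂ} (hμ : μ.re < 0) :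
    IntegrableOn (fun y : ℝ => (y : ℂ) ^ n * Complex.exp (μ * y)) (Ioi 0) := by
  have h := integrableOn_rpow_mul_exp_neg_mul_rpow (p := 1) (s := n) (b := -μ.re)
    (by linarith [n.cast_nonneg (α := ℝ)]) one_pos (by linarith)
  refine h.mono' (by fun_prop) ((ae_restrict_iff' measurableSet_Ioi).mpr (.of_forall ?_))
  intro y hy
  simp [Complex.norm_exp, abs_of_pos (mem_Ioi.mp hy)]

open MeasureTheory Set in
theorem memLp_two_pow_mul_cexp_Ioi (n : ℕ) {μ : ℂ} (hμ : μ.re < 0) :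
    MemLp (fun y : ℝ => (y : ℂ) ^ n * Complex.exp (μ * y)) 2 (volume.restrict (Ioi 0)) := by
  rw [memLp_two_iff_integrable_sq_norm (by fun_prop)]
  refine (integrableOn_pow_mul_cexp_Ioi (n * 2) (μ := μ + μ) (by simp; linarith)).norm.congr
    (.of_forall fun y => ?_)
  simp only [norm_mul, norm_pow, Complex.norm_exp, mul_pow, ← pow_mul, ← Real.exp_nat_mul]
  congr 2
  simp; ring

open MeasureTheory Set Filter Topology in
theorem integral_pow_mul_cexp_Ioi (n : ℕ) {μ : ℂ} (hμ : μ.re < 0) :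
    ∫ y in Ioi (0 : ℝ), (y : ℂ) ^ n * Complex.exp (μ * y) = n.factorial / (-μ) ^ (n + 1) := by
  have hμ0 : μ ≠ 0 := by rintro rfl; simp at hμ
  induction n with
  | zero =>
    simp only [pow_zero, one_mul, integral_exp_mul_complex_Ioi hμ 0, zero_add, pow_one,
      Nat.factorial_zero, Nat.cast_one, Complex.ofReal_zero, mul_zero, Complex.exp_zero]
    rw [div_neg, neg_div]
  | succ n ih =>
    have hderiv : ∀ y ∈ Ici (0 : ℝ), HasDerivAt
        (fun y : ℝ => (y : ℂ) ^ (n + 1) * Complex.exp (μ * y))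
        ((n + 1) * ((y : ℂ) ^ n * Complex.exp (μ * y)) +
          μ * ((y : ℂ) ^ (n + 1) * Complex.exp (μ * y))) y := by
      intro y _
      have h : HasDerivAt (fun z : ℂ => z ^ (n + 1) * Complex.exp (μ * z))
          ((n + 1) * ((y : ℂ) ^ n * Complex.exp (μ * y)) +
            μ * ((y : ℂ) ^ (n + 1) * Complex.exp (μ * y))) y := by
        convert! (hasDerivAt_pow (n + 1) (y : ℂ)).mul
          (((hasDerivAt_id (y : ℂ)).const_mul μ).cexp) using 1
        simp; ring
      exact h.comp_ofReal
    have hlim : Tendsto (fun y : ℝ => (y : ℂ) ^ (n + 1) * Complex.exp (μ * y)) atTop (𝓝 0) := by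
      rw [tendsto_zero_iff_norm_tendsto_zero]
      refine (tendsto_rpow_mul_exp_neg_mul_atTop_nhds_zero (n + 1 : ℕ) (-μ.re)
        (by linarith)).congr' ?_
      filter_upwards [eventually_gt_atTop 0] with y hy
      rw [Real.rpow_natCast]
      simp [Complex.norm_exp, abs_of_pos hy]
    have i1 := (integrableOn_pow_mul_cexp_Ioi n hμ).const_mul (n + 1 : ℂ)
    have i2 := (integrableOn_pow_mul_cexp_Ioi (n + 1) hμ).const_mul μ
    have h := integral_Ioi_of_hasDerivAt_of_tendsto' hderiv (i1.add i2) hlim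
    rw [integral_add i1 i2, integral_const_mul, integral_const_mul, ih] at h
    have hn : (-μ) ≠ 0 := neg_ne_zero.mpr hμ0
    have h' : ∫ y in Ioi (0 : ℝ), (y : ℂ) ^ (n + 1) * Complex.exp (μ * y) =
        (n + 1) * (n.factorial / (-μ) ^ (n + 1)) / (-μ) := by
      rw [eq_div_iff hn]
      simp at h
      linear_combination -h
    rw [h', Nat.factorial_succ]
    push_cast
    rw [pow_succ _ (n + 1)]
    field_simp

/-- The Gram matrix in `L²(0, ∞)` of the functions `(i y)^s / s! * exp (i λ_k y)`,
in closed form. -/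
noncomputable def cauchyGram {N : ℕ} (lam : Fin N → ℂ) (m : Fin N → ℕ) :
    Matrix ((j : Fin N) × Fin (m j + 1)) ((j : Fin N) × Fin (m j + 1)) ℂ :=
  Matrix.of fun p q => -Complex.I * (-1) ^ (p.2 : ℕ) *
    ((p.2 + q.2 : ℕ).choose p.2 : ℂ) *
      (((starRingEnd ℂ) (lam p.1) - lam q.1) ^ ((p.2 : ℕ) + q.2 + 1))⁻¹

open MeasureTheory Set Polynomial in
theorem linearIndependent_toLp_pow_mul_cexp {N : ℕ} {μ : Fin N → ℂ}
    (hinj : Function.Injective μ) (hμ : ∀ k, (μ k).re < 0) (m : Fin N → ℕ) :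
    LinearIndependent ℂ fun p : (j : Fin N) × Fin (m j + 1) =>
      (memLp_two_pow_mul_cexp_Ioi p.2 (hμ p.1)).toLp := by
  rw [Fintype.linearIndependent_iff]
  intro c hc
  have hae : (fun y : ℝ => ∑ p : (j : Fin N) × Fin (m j + 1),
      c p * ((y : ℂ) ^ (p.2 : ℕ) * Complex.exp (μ p.1 * y)))
      =ᵐ[volume.restrict (Ioi 0)] fun _ => 0 := by
    have h0 : (∑ p, c p • (memLp_two_pow_mul_cexp_Ioi p.2 (hμ p.1)).toLp : Lp ℂ 2 _)
        =ᵐ[volume.restrict (Ioi 0)] fun _ => 0 := by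
      rw [hc]; exact Lp.coeFn_zero _ _ _
    refine Filter.EventuallyEq.trans ?_ h0
    have hterm : ∀ᵐ y ∂(volume.restrict (Ioi (0 : ℝ))),
        ∀ p : (j : Fin N) × Fin (m j + 1),
        (c p • (memLp_two_pow_mul_cexp_Ioi p.2 (hμ p.1)).toLp : Lp ℂ 2 _) y =
          c p * ((y : ℂ) ^ (p.2 : ℕ) * Complex.exp (μ p.1 * y)) := by
      rw [ae_all_iff]
      intro p
      filter_upwards [Lp.coeFn_smul (c p) (memLp_two_pow_mul_cexp_Ioi p.2 (hμ p.1)).toLp,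
        (memLp_two_pow_mul_cexp_Ioi p.2 (hμ p.1)).coeFn_toLp] with y h1 h2
      rw [h1, Pi.smul_apply, h2, smul_eq_mul]
    filter_upwards [hterm, Lp.coeFn_fun_finsetSum Finset.univ fun p =>
      c p • (memLp_two_pow_mul_cexp_Ioi p.2 (hμ p.1)).toLp] with y h1 h2
    rw [h2]
    exact Finset.sum_congr rfl fun p _ => (h1 p).symm
  have heq := Measure.eqOn_open_of_ae_eq hae isOpen_Ioi
    (by fun_prop) continuousOn_const
  have hpoly := eq_zero_of_sum_eval_mul_exp_eq_zero μ hinj Finset.univ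
    (fun k => ∑ s : Fin (m k + 1), C (c ⟨k, s⟩) * X ^ (s : ℕ)) fun y hy => by
      refine Eq.trans ?_ (heq hy)
      dsimp only
      rw [Fintype.sum_sigma]
      refine Finset.sum_congr rfl fun k _ => ?_
      simp [eval_finsetSum, Finset.sum_mul, mul_assoc]
  rintro ⟨k, s⟩
  have := congrArg (fun p => coeff p s) (hpoly k (Finset.mem_univ k))
  simpa [finsetSum_coeff, coeff_X_pow, Fin.val_inj] using this

open MeasureTheory in
theorem posDef_cauchyGram {N : ℕ} {lam : Fin N → ℂ} (hinj : Function.Injective lam)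
    (him : ∀ k, 0 < (lam k).im) (m : Fin N → ℕ) : (cauchyGram lam m).PosDef := by
  have hre : ∀ k, (Complex.I * lam k).re < 0 := fun k => by simpa using him k
  have hli := linearIndependent_toLp_pow_mul_cexp (μ := fun k => Complex.I * lam k)
    (fun a b h => hinj (mul_left_cancel₀ Complex.I_ne_zero h)) hre m
  let w : (j : Fin N) × Fin (m j + 1) → ℂˣ := fun p =>
    Units.mk0 (Complex.I ^ (p.2 : ℕ) / ((p.2 : ℕ).factorial : ℂ))
      (div_ne_zero (pow_ne_zero _ Complex.I_ne_zero)
        (Nat.cast_ne_zero.mpr (Nat.factorial_ne_zero _)))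
  have hG := Matrix.posDef_gram_of_linearIndependent (hli.units_smul w)
  suffices h : cauchyGram lam m = _ from h ▸ hG
  ext p q
  rw [Matrix.gram_apply]
  simp only [Pi.smul_apply', Units.smul_def]
  rw [inner_smul_left, inner_smul_right, L2.inner_def]
  have h_inner : ∫ y in Set.Ioi (0 : ℝ),
      inner ℂ ((memLp_two_pow_mul_cexp_Ioi p.2 (hre p.1)).toLp _ y)
        ((memLp_two_pow_mul_cexp_Ioi q.2 (hre q.1)).toLp _ y) =
      ∫ y in Set.Ioi (0 : ℝ), (y : ℂ) ^ ((p.2 : ℕ) + q.2) *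
        Complex.exp ((Complex.I * (lam q.1 - (starRingEnd ℂ) (lam p.1))) * y) := by
    refine integral_congr_ae ?_
    filter_upwards [(memLp_two_pow_mul_cexp_Ioi p.2 (hre p.1)).coeFn_toLp,
      (memLp_two_pow_mul_cexp_Ioi q.2 (hre q.1)).coeFn_toLp] with y h1 h2
    rw [h1, h2, RCLike.inner_apply, map_mul, map_pow, Complex.conj_ofReal, ← Complex.exp_conj,
      mul_mul_mul_comm, ← pow_add, ← Complex.exp_add, add_comm (q.2 : ℕ)]
    congr 2
    simp; ring
  rw [h_inner, integral_pow_mul_cexp_Ioi _ (by simpa using by linarith [him p.1, him q.1])]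
  have hw : (starRingEnd ℂ) (lam p.1) - lam q.1 ≠ 0 := fun h => by
    have := congrArg Complex.im h
    simp at this
    linarith [him p.1, him q.1]
  have hp : ((p.2 : ℕ).factorial : ℂ) ≠ 0 := Nat.cast_ne_zero.mpr (Nat.factorial_ne_zero _)
  have hq : ((q.2 : ℕ).factorial : ℂ) ≠ 0 := Nat.cast_ne_zero.mpr (Nat.factorial_ne_zero _)
  have hneg : -(Complex.I * (lam q.1 - (starRingEnd ℂ) (lam p.1))) =
      Complex.I * ((starRingEnd ℂ) (lam p.1) - lam q.1) := by ring
  have hI : ∀ n : ℕ, ((Complex.I ^ n)⁻¹) = (-Complex.I) ^ n := fun n => by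
    rw [← inv_pow, Complex.inv_I]
  have hch : ((p.2 + q.2 : ℕ).choose p.2 : ℂ) =
      ((p.2 + q.2 : ℕ).factorial : ℂ) / ((p.2 : ℕ).factorial * (q.2 : ℕ).factorial) :=
    Nat.cast_add_choose ℂ
  have hII : (-Complex.I) ^ (p.2 : ℕ) * Complex.I ^ (q.2 : ℕ) *
      (-Complex.I) ^ ((p.2 : ℕ) + q.2 + 1) = -Complex.I * (-1) ^ (p.2 : ℕ) := by
    have h1 : (-Complex.I) * (-Complex.I) = -1 := by simp
    have h2 : Complex.I * (-Complex.I) = 1 := by simp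
    calc _ = (-Complex.I * -Complex.I) ^ (p.2 : ℕ) * (Complex.I * -Complex.I) ^ (q.2 : ℕ) *
          -Complex.I := by rw [mul_pow, mul_pow]; ring
      _ = _ := by rw [h1, h2]; ring
  simp only [cauchyGram, Matrix.of_apply, w, Units.val_mk0]
  rw [hneg, hch, mul_pow Complex.I, map_div₀, map_pow, Complex.conj_I, map_natCast, ← hII]
  rw [div_eq_mul_inv _ (Complex.I ^ _ * _), mul_inv, hI]
  field_simp

/-- The matrix `cauchyGram ⊗ I₂`, on the index set of `Amat`. -/
noncomputable def blockCauchyGram {N : ℕ} (lam : Fin N → ℂ) (m : Fin N → ℕ) :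
    Matrix ((j : Fin N) × (Fin (m j + 1) × Fin 2)) ((j : Fin N) × (Fin (m j + 1) × Fin 2)) ℂ :=
  Matrix.of fun p q =>
    if p.2.2 = q.2.2 then cauchyGram lam m ⟨p.1, p.2.1⟩ ⟨q.1, q.2.1⟩ else 0

theorem posDef_blockCauchyGram {N : ℕ} {lam : Fin N → ℂ} (hinj : Function.Injective lam)
    (him : ∀ k, 0 < (lam k).im) (m : Fin N → ℕ) : (blockCauchyGram lam m).PosDef := by
  have h := ((posDef_cauchyGram hinj him m).kronecker
    (Matrix.PosDef.one (n := Fin 2) (R := ℂ))).submatrix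
    (e := fun p : (j : Fin N) × (Fin (m j + 1) × Fin 2) =>
      ((⟨p.1, p.2.1⟩, p.2.2) : ((j : Fin N) × Fin (m j + 1)) × Fin 2)) (by
        rintro ⟨j, r, a⟩ ⟨k, s, b⟩ h
        simp only [Prod.mk.injEq, Sigma.mk.injEq] at h
        obtain ⟨⟨rfl, h⟩, rfl⟩ := h
        rw [eq_of_heq h])
  suffices hB : blockCauchyGram lam m = _ from hB ▸ h
  ext p q
  simp [blockCauchyGram, Matrix.kroneckerMap_apply, Matrix.one_apply]

/-- The block diagonal matrix whose blocks are the lower triangular block Toeplitz matrices of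
Taylor coefficients of `ȟ` at `conj(λ_j)`. -/
noncomputable def taylorToeplitz (x t : ℝ) {N : ℕ} (lam : Fin N → ℂ) (m : Fin N → ℕ)
    (f : Matrix (Fin 2) (Fin 2) (Polynomial ℂ)) :
    Matrix ((j : Fin N) × (Fin (m j + 1) × Fin 2)) ((j : Fin N) × (Fin (m j + 1) × Fin 2)) ℂ :=
  Matrix.of fun p q =>
    if p.1 = q.1 ∧ (q.2.1 : ℕ) ≤ p.2.1 then
      iteratedDeriv (p.2.1 - q.2.1 : ℕ) (hCheck x t f p.2.2 q.2.2) ((starRingEnd ℂ) (lam p.1)) /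
        ((p.2.1 - q.2.1 : ℕ).factorial : ℂ)
    else 0

open Polynomial in
theorem hCheck_eq (x t : ℝ) (f : Matrix (Fin 2) (Fin 2) ℂ[X]) (a b : Fin 2) :
    hCheck x t f a b = fun z => Complex.exp (-2 * Complex.I * (z * x + 2 * z ^ 2 * t)) *
      ((f b a).map (starRingEnd ℂ)).eval z := by
  funext z
  have h : (starRingEnd ℂ) ((f b a).eval ((starRingEnd ℂ) z)) =
      ((f b a).map (starRingEnd ℂ)).eval z := by
    rw [← eval_map_apply, Complex.conj_conj]
  rw [hCheck, map_mul, ← Complex.exp_conj, h]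
  simp [Complex.conj_ofReal, map_ofNat]

theorem contDiff_hCheck (x t : ℝ) (f : Matrix (Fin 2) (Fin 2) (Polynomial ℂ)) (a b : Fin 2)
    (n : WithTop ℕ∞) : ContDiff ℂ n (hCheck x t f a b) := by
  rw [hCheck_eq]
  have : ContDiff ℂ n fun z : ℂ => ((f b a).map (starRingEnd ℂ)).eval z := by
    simpa using ((f b a).map (starRingEnd ℂ)).contDiff_aeval (𝕜 := ℂ) n
  fun_prop

theorem hCheck_symm (x t : ℝ) {f : Matrix (Fin 2) (Fin 2) (Polynomial ℂ)} (hf : fᵀ = f)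
    (a b : Fin 2) : hCheck x t f a b = hCheck x t f b a := by
  have : f a b = f b a := congrFun (congrFun hf b) a
  funext z
  rw [hCheck, hCheck, this]

theorem iteratedDeriv_inv_pow_sub (c z : ℂ) (s l : ℕ) :
    iteratedDeriv l (fun z => ((z - c) ^ (s + 1))⁻¹) z =
      l.factorial * ((-1) ^ l * ((l + s).choose l : ℂ) * ((z - c) ^ (l + s + 1))⁻¹) := by
  have h := iteratedDeriv_comp_sub_const l (fun z : ℂ => z ^ (-((s + 1 : ℕ) : ℤ))) c
  simp only [zpow_neg, zpow_natCast] at h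
  rw [h]
  have h2 : (fun z : ℂ => (z ^ (s + 1))⁻¹) = fun z : ℂ => z ^ (-((s + 1 : ℕ) : ℤ)) := by
    funext z; simp only [zpow_neg, zpow_natCast]
  rw [h2, iteratedDeriv_eq_iterate]
  simp only [iter_deriv_zpow']
  have h3 : ∏ i ∈ Finset.range l, (((-((s + 1 : ℕ) : ℤ) : ℤ) : ℂ) - i) =
      l.factorial * ((-1) ^ l * ((l + s).choose l : ℂ)) := by
    have h4 := Nat.ascFactorial_eq_factorial_mul_choose s l
    rw [Nat.ascFactorial_eq_prod_range] at h4
    have h5 := congrArg (Nat.cast : ℕ → ℂ) h4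
    push_cast at h5
    rw [add_comm l s, mul_left_comm, ← h5]
    have h6 := Finset.prod_neg (s := Finset.range l) fun i : ℕ => (s + 1 + i : ℂ)
    rw [Finset.card_range] at h6
    rw [← h6]
    refine Finset.prod_congr rfl fun i _ => ?_
    push_cast
    ring
  rw [h3, mul_assoc]
  congr 2
  rw [← zpow_natCast, ← zpow_neg]
  congr 1
  push_cast
  ring

theorem Amat_eq_taylorToeplitz_mul (x t : ℝ) {N : ℕ} {lam : Fin N → ℂ}
    (him : ∀ k, 0 < (lam k).im) (m : Fin N → ℕ) (f : Matrix (Fin 2) (Fin 2) (Polynomial ℂ)) :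
    Amat x t N lam m f = taylorToeplitz x t lam m f * blockCauchyGram lam m := by
  ext ⟨j, r, a⟩ ⟨k, s, b⟩
  have hw : (starRingEnd ℂ) (lam j) - lam k ≠ 0 := fun h => by
    have := congrArg Complex.im h
    simp at this
    linarith [him j, him k]
  have hg : ContDiffAt ℂ (r : ℕ) (fun z => ((z - lam k) ^ ((s : ℕ) + 1))⁻¹)
      ((starRingEnd ℂ) (lam j)) :=
    ContDiffAt.inv (by fun_prop) (pow_ne_zero _ hw)
  rw [Matrix.mul_apply, Fintype.sum_sigma, Finset.sum_eq_single j
    (fun i _ hij => Finset.sum_eq_zero fun q _ => by simp [taylorToeplitz, hij.symm])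
    (by simp), Fintype.sum_prod_type]
  simp only [Amat, taylorToeplitz, blockCauchyGram, Matrix.of_apply, mul_ite, mul_zero,
    Finset.sum_ite_eq', Finset.mem_univ, if_true, true_and]
  have hfun : (fun z => hCheck x t f a b z * ((z - lam k) ^ ((s : ℕ) + 1))⁻¹) =
      fun z => ((z - lam k) ^ ((s : ℕ) + 1))⁻¹ * hCheck x t f a b z :=
    funext fun z => mul_comm _ _
  rw [hfun, iteratedDeriv_fun_mul hg (contDiff_hCheck x t f a b _).contDiffAt, Finset.mul_sum]
  simp only [cauchyGram, Matrix.of_apply]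
  rw [Fin.sum_univ_eq_sum_range (fun l => (if l ≤ (r : ℕ) then
    iteratedDeriv (r - l : ℕ) (hCheck x t f a b) ((starRingEnd ℂ) (lam j)) /
      ((r - l : ℕ).factorial : ℂ) else 0) * (-Complex.I * (-1) ^ l * ((l + s : ℕ).choose l : ℂ) *
        (((starRingEnd ℂ) (lam j) - lam k) ^ (l + (s : ℕ) + 1))⁻¹))]
  refine Eq.trans (Finset.sum_congr rfl fun l hl => ?_)
    (Finset.sum_subset (Finset.range_subset_range.mpr r.isLt) fun l _ hl => ?_)
  · have hlr : l ≤ (r : ℕ) := Nat.lt_succ_iff.mp (Finset.mem_range.mp hl)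
    have hfac : ∀ n : ℕ, (n.factorial : ℂ) ≠ 0 := fun n =>
      Nat.cast_ne_zero.mpr n.factorial_ne_zero
    rw [if_pos hlr, iteratedDeriv_inv_pow_sub, Nat.cast_choose ℂ hlr]
    field_simp [hfac r, hfac l, hfac (r - l)]
  · rw [if_neg (fun h => hl (Finset.mem_range.mpr (Nat.lt_succ_iff.mpr h))), zero_mul]

theorem taylorToeplitz_rev (x t : ℝ) {N : ℕ} (lam : Fin N → ℂ) (m : Fin N → ℕ)
    {f : Matrix (Fin 2) (Fin 2) (Polynomial ℂ)} (hf : fᵀ = f)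
    (p q : (j : Fin N) × (Fin (m j + 1) × Fin 2)) :
    taylorToeplitz x t lam m f ⟨p.1, (p.2.1.rev, p.2.2)⟩ ⟨q.1, (q.2.1.rev, q.2.2)⟩ =
      taylorToeplitz x t lam m f q p := by
  obtain ⟨j, r, a⟩ := p
  obtain ⟨k, s, b⟩ := q
  by_cases hjk : j = k
  · subst hjk
    simp only [taylorToeplitz, Matrix.of_apply, true_and, Fin.val_rev, hCheck_symm x t hf a b]
    have h1 : (m j + 1 - (s + 1 : ℕ) ≤ m j + 1 - (r + 1 : ℕ)) ↔ (r : ℕ) ≤ s := by omega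
    have h2 : m j + 1 - (r + 1 : ℕ) - (m j + 1 - (s + 1 : ℕ)) = (s : ℕ) - r := by omega
    simp only [h1, h2]
  · simp [taylorToeplitz, hjk, Ne.symm hjk]

theorem taylorToeplitz_ne_zero (x t : ℝ) {N : ℕ} (hN : 0 < N) (lam : Fin N → ℂ) (m : Fin N → ℕ)
    {f : Matrix (Fin 2) (Fin 2) (Polynomial ℂ)}
    (hf : ∀ k, (Matrix.of fun a b => (f a b).eval (lam k)) ≠ (0 : Matrix (Fin 2) (Fin 2) ℂ)) :
    taylorToeplitz x t lam m f ≠ 0 := by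
  intro h
  refine hf ⟨0, hN⟩ ?_
  ext a b
  have hab := congrFun (congrFun h ⟨⟨0, hN⟩, (0, b)⟩) ⟨⟨0, hN⟩, (0, a)⟩
  simpa [taylorToeplitz, hCheck, Complex.exp_ne_zero] using hab

/-- The involution of the index set reversing the order of derivatives in each block. -/
def revIndex {N : ℕ} (m : Fin N → ℕ) : Equiv.Perm ((j : Fin N) × (Fin (m j + 1) × Fin 2)) :=
  Equiv.sigmaCongrRight fun _ => Equiv.prodCongr Fin.revPerm (Equiv.refl _)

theorem Bmat_map_conj (x t : ℝ) {N : ℕ} {lam : Fin N → ℂ}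
    (him : ∀ k, 0 < (lam k).im) (m : Fin N → ℕ) {f : Matrix (Fin 2) (Fin 2) (Polynomial ℂ)}
    (hf : fᵀ = f) :
    (Bmat x t N lam m f).map (starRingEnd ℂ) = (taylorToeplitz x t lam m f)ᴴ *
      (((blockCauchyGram lam m).map (starRingEnd ℂ)).submatrix (revIndex m) (revIndex m)) := by
  have hB : Bmat x t N lam m f =
      (Amat x t N lam m f).submatrix (revIndex m) (revIndex m) := rfl
  have hT : (taylorToeplitz x t lam m f).submatrix (revIndex m) (revIndex m) =
      (taylorToeplitz x t lam m f)ᵀ := by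
    ext p q
    exact taylorToeplitz_rev x t lam m hf p q
  rw [hB, Amat_eq_taylorToeplitz_mul x t him, ← Matrix.submatrix_mul_equiv _ _ _ (revIndex m) _,
    hT, Matrix.map_mul, Matrix.submatrix_map]
  rfl

/-- For distinct `λ₁,…,λ_N` in the upper half-plane, multiplicities `m_k`, and a
polynomial `f` with symmetric `2×2` matrix coefficients such that `f(λ_k) ≠ 0` for all
`k`, the determinant of `I + A·conj(B)` is a real number strictly greater than `1`;
in particular `I + A·conj(B)` is invertible and the linear system
`(I + A·conj(B))·X = H` has a unique solution for every `H`. -/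
theorem det_inverse_scattering_system (x t : ℝ) (N : ℕ) (hN : 0 < N)
    (lam : Fin N → ℂ) (hinj : Function.Injective lam) (him : ∀ k, 0 < (lam k).im)
    (m : Fin N → ℕ) (f : Matrix (Fin 2) (Fin 2) (Polynomial ℂ))
    (hfsym : fᵀ = f)
    (hfne : ∀ k, (Matrix.of fun a b => (f a b).eval (lam k)) ≠ (0 : Matrix (Fin 2) (Fin 2) ℂ)) :
    (1 : ℂ) <
      ((1 : Matrix _ _ ℂ) +
        Amat x t N lam m f * (Bmat x t N lam m f).map (starRingEnd ℂ)).det ∧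
    IsUnit ((1 : Matrix _ _ ℂ) +
        Amat x t N lam m f * (Bmat x t N lam m f).map (starRingEnd ℂ)) ∧
    ∀ H : (j : Fin N) × (Fin (m j + 1) × Fin 2) → ℂ,
      ∃! X : (j : Fin N) × (Fin (m j + 1) × Fin 2) → ℂ,
        ((1 : Matrix _ _ ℂ) +
          Amat x t N lam m f * (Bmat x t N lam m f).map (starRingEnd ℂ)).mulVec X = H := by
  have hG := posDef_blockCauchyGram hinj him m
  have hK : (((blockCauchyGram lam m).map (starRingEnd ℂ)).submatrix
      (revIndex m) (revIndex m)).PosDef := by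
    have h : (blockCauchyGram lam m).map (starRingEnd ℂ) = (blockCauchyGram lam m)ᵀ := by
      conv_rhs => rw [← hG.isHermitian]
      rfl
    rw [h]
    exact hG.transpose.submatrix (revIndex m).injective
  have hdet : (1 : ℂ) < ((1 : Matrix _ _ ℂ) +
      Amat x t N lam m f * (Bmat x t N lam m f).map (starRingEnd ℂ)).det := by
    rw [Bmat_map_conj x t him m hfsym, Amat_eq_taylorToeplitz_mul x t him, ← Matrix.mul_assoc]
    exact hG.one_lt_det_one_add_mul hK (taylorToeplitz_ne_zero x t hN lam m hfne)
  have hunit := (Matrix.isUnit_iff_isUnit_det _).mpr (zero_lt_one.trans hdet).ne'.isUnit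
  exact ⟨hdet, hunit, fun H => Function.Bijective.existsUnique
    ⟨Matrix.mulVec_injective_iff_isUnit.mpr hunit, Matrix.mulVec_surjective_iff_isUnit.mpr hunit⟩ H⟩
end
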